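/- Let {G_n}_{n≥0} be a crossed simplicial group and n ≥ 1. For each g ∈ G_n the assignment θ_g^{-1}(i) = j, where j is determined by g*(δ_i) = δ_j, defines a well-defined permutation θ_g ∈ Σ_{n+1} of {0,…,n}, and the map V_n: G_n → Σ_{n+1}, g ↦ θ_g, satisfies θ_{gh} = θ_g θ_h for all g,h ∈ G_n, i.e., it is a group homomorphism. -/

import Mathlib

/-!
STATEMENT 5: in a crossed simplicial group, the assignment `θ_g⁻¹(i) = j` where
`g*(δ_i) = δ_j` defines a well-defined permutation `θ_g ∈ Σ_{n+1}`, and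
`g ↦ θ_g` satisfies `θ_{gh} = θ_g θ_h`, i.e. it is a group homomorphism
`V_n : G_n → Σ_{n+1}`.
-/

open CategoryTheory SimplexCategory

/-- A crossed simplicial group: a sequence of groups `{G_n}` together with operations
`ψ*(g) ∈ G_m` and `g*(ψ) ∈ Δ([m],[n])` for every `ψ ∈ Δ([m],[n])` and `g ∈ G_n`,
satisfying the six crossed-simplicial-group identities
(1.h), (2.h), (3.h), (1.v), (2.v), (3.v). -/
structure CSG (G : ℕ → Type) [∀ n, Group (G n)] : Type where
  hact : ∀ {m n : ℕ}, (mk m ⟶ mk n) → G n → G m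
  vact : ∀ {m n : ℕ}, G n → (mk m ⟶ mk n) → (mk m ⟶ mk n)
  id1h : ∀ {k m n : ℕ} (ψ : mk m ⟶ mk n) (χ : mk k ⟶ mk m) (g : G n),
    hact (χ ≫ ψ) g = hact χ (hact ψ g)
  id3h₁ : ∀ {n : ℕ} (g : G n), hact (𝟙 (mk n)) g = g
  id3h₂ : ∀ {m n : ℕ} (ψ : mk m ⟶ mk n), hact ψ (1 : G n) = 1
  id1v : ∀ {m n : ℕ} (g h : G n) (ψ : mk m ⟶ mk n), vact (g * h) ψ = vact h (vact g ψ)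
  id3v₁ : ∀ {m n : ℕ} (ψ : mk m ⟶ mk n), vact (1 : G n) ψ = ψ
  id3v₂ : ∀ {n : ℕ} (g : G n), vact g (𝟙 (mk n)) = 𝟙 (mk n)
  id2h : ∀ {k m n : ℕ} (ψ : mk m ⟶ mk n) (χ : mk k ⟶ mk m) (g : G n),
    vact g (χ ≫ ψ) = vact (hact ψ g) χ ≫ vact g ψ
  id2v : ∀ {m n : ℕ} (ψ : mk m ⟶ mk n) (g h : G n),
    hact ψ (g * h) = hact ψ g * hact (vact g ψ) h

namespace CSG

variable {G : ℕ → Type} [∀ n, Group (G n)] (C : CSG G)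

theorem vact_inv_vact {m n : ℕ} (g : G n) (ψ : SimplexCategory.mk m ⟶ SimplexCategory.mk n) :
    C.vact g⁻¹ (C.vact g ψ) = ψ := by
  rw [← C.id1v, mul_inv_cancel, C.id3v₁]

theorem vact_injective {m n : ℕ} (g : G n) :
    Function.Injective (C.vact g : (SimplexCategory.mk m ⟶ SimplexCategory.mk n) → _) :=
  Function.LeftInverse.injective (C.vact_inv_vact g)

/-- A morphism that factors through a lower-dimensional simplex still does so after acting on it;
as the action is invertible, it preserves monomorphisms. -/
theorem mono_vact {m n : ℕ} (g : G n) (ψ : SimplexCategory.mk m ⟶ SimplexCategory.mk n)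
    [hψ : Mono ψ] : Mono (C.vact g ψ) := by
  rw [SimplexCategory.mono_iff_injective] at hψ ⊢
  by_contra hg
  cases m with
  | zero => exact hg (Function.injective_of_subsingleton (α := Fin 1) _)
  | succ k =>
    obtain ⟨i, χ, hχ⟩ := SimplexCategory.eq_σ_comp_of_not_injective _ hg
    have ψ_factors : ψ = C.vact (C.hact χ g⁻¹) (SimplexCategory.σ i) ≫ C.vact g⁻¹ χ := by
      rw [← C.id2h, ← hχ, C.vact_inv_vact]
    rw [← SimplexCategory.mono_iff_injective, ψ_factors] at hψ
    have := mono_of_mono (C.vact (C.hact χ g⁻¹) (SimplexCategory.σ i)) (C.vact g⁻¹ χ)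
    have hle := SimplexCategory.len_le_of_mono (C.vact (C.hact χ g⁻¹) (SimplexCategory.σ i))
    simp at hle

end CSG

theorem stmt5 (G : ℕ → Type) [∀ n, Group (G n)] (C : CSG G) (m : ℕ) :
    -- the permutation `θ_g` with `g*(δ_i) = δ_{θ_g⁻¹(i)}` is well defined:
    (∀ g : G (m + 1), ∃! θ : Equiv.Perm (Fin (m + 2)),
      ∀ i : Fin (m + 2), C.vact g (SimplexCategory.δ i) = SimplexCategory.δ (θ⁻¹ i)) ∧
    -- and `g ↦ θ_g` is multiplicative: `θ_{gh} = θ_g θ_h`: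
    (∀ (g h : G (m + 1)) (θg θh θgh : Equiv.Perm (Fin (m + 2))),
      (∀ i : Fin (m + 2), C.vact g (SimplexCategory.δ i) = SimplexCategory.δ (θg⁻¹ i)) →
      (∀ i : Fin (m + 2), C.vact h (SimplexCategory.δ i) = SimplexCategory.δ (θh⁻¹ i)) →
      (∀ i : Fin (m + 2), C.vact (g * h) (SimplexCategory.δ i) = SimplexCategory.δ (θgh⁻¹ i)) →
      θgh = θg * θh) := by
  refine ⟨fun g => ?_, fun g h θg θh θgh hg hh hgh => ?_⟩
  · choose f hf using fun i : Fin (m + 2) =>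
      have := C.mono_vact g (SimplexCategory.δ i)
      SimplexCategory.eq_δ_of_mono (C.vact g (SimplexCategory.δ i))
    have f_inj : Function.Injective f := fun i j hij =>
      SimplexCategory.δ_injective (C.vact_injective g (by rw [hf, hf, hij]))
    refine ⟨(Equiv.ofBijective f (Finite.injective_iff_bijective.mp f_inj))⁻¹, fun i => ?_,
      fun θ hθ => ?_⟩
    · simpa using hf i
    · refine inv_injective (Equiv.ext fun i => SimplexCategory.δ_injective ?_)
      simpa [hf i] using (hθ i).symm
  · refine inv_injective (Equiv.ext fun i => SimplexCategory.δ_injective ?_)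
    rw [← hgh, C.id1v, hg, hh, mul_inv_rev, Equiv.Perm.mul_apply]
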